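/- Let w₁, w₂ be nonzero complex numbers with w₁/w₂ ∉ ℝ. If F : ℂ → ℂ is holomorphic on all of ℂ (entire) and doubly periodic, i.e. F(z + w₁) = F(z) and F(z + w₂) = F(z) for all z ∈ ℂ, then F is constant. -/

import Mathlib

/-- Two complex numbers with non-real ratio are linearly independent over `ℝ`. -/
lemma linearIndependent_pair_of_div_notMem_range_ofReal {w₁ w₂ : ℂ} (hw₂ : w₂ ≠ 0)
    (hratio : w₁ / w₂ ∉ Set.range ((↑) : ℝ → ℂ)) : LinearIndependent ℝ ![w₁, w₂] := by
  refine LinearIndependent.pair_iff.mpr fun s t h ↦ ?_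
  simp only [Complex.real_smul] at h
  have hs : s = 0 := by
    by_contra hs
    have hs' : (s : ℂ) ≠ 0 := by exact_mod_cast hs
    refine hratio ⟨-t / s, ?_⟩
    push_cast
    rw [div_eq_div_iff hs' hw₂]
    linear_combination -h
  subst hs
  simpa [hw₂] using h

/-- A continuous function on `ℂ` with two periods linearly independent over `ℝ` is bounded. -/
lemma isBounded_range_of_periodic_pair {E : Type*} [PseudoMetricSpace E] {F : ℂ → E} {w₁ w₂ : ℂ}
    (hw : LinearIndependent ℝ ![w₁, w₂]) (hF : Continuous F)
    (hper₁ : Function.Periodic F w₁) (hper₂ : Function.Periodic F w₂) :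
    Bornology.IsBounded (Set.range F) := by
  refine (((isCompact_closedBall (0 : ℂ) (‖w₁‖ + ‖w₂‖)).image hF).isBounded).subset ?_
  rintro _ ⟨z, rfl⟩
  let L : PeriodPair := ⟨w₁, w₂, hw⟩
  obtain ⟨a, b, hz⟩ : ∃ a b : ℝ, (a : ℂ) * w₁ + b * w₂ = z :=
    ⟨L.basis.repr z 0, L.basis.repr z 1, by simpa [Fin.sum_univ_two, L] using L.basis.sum_repr z⟩
  have norm_fract_mul_le (x : ℝ) (w : ℂ) : ‖((Int.fract x : ℝ) : ℂ) * w‖ ≤ ‖w‖ := by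
    rw [norm_mul, Complex.norm_real, Real.norm_of_nonneg (Int.fract_nonneg x)]
    exact mul_le_of_le_one_left (norm_nonneg w) (Int.fract_lt_one x).le
  refine ⟨((Int.fract a : ℝ) : ℂ) * w₁ + ((Int.fract b : ℝ) : ℂ) * w₂, ?_, ?_⟩
  · rw [mem_closedBall_zero_iff]
    exact (norm_add_le _ _).trans (add_le_add (norm_fract_mul_le a w₁) (norm_fract_mul_le b w₂))
  · rw [← hper₁.int_mul ⌊a⌋, ← hper₂.int_mul ⌊b⌋, ← hz]
    congr 1
    simp only [Int.fract]
    push_cast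
    ring

theorem entire_doubly_periodic_constant (w₁ w₂ : ℂ) (hw₁ : w₁ ≠ 0) (hw₂ : w₂ ≠ 0)
    (hratio : w₁ / w₂ ∉ Set.range ((↑) : ℝ → ℂ))
    (F : ℂ → ℂ) (hF : Differentiable ℂ F)
    (hper₁ : ∀ z : ℂ, F (z + w₁) = F z) (hper₂ : ∀ z : ℂ, F (z + w₂) = F z) :
    ∃ c : ℂ, ∀ z : ℂ, F z = c :=
  hF.exists_const_forall_eq_of_bounded <| isBounded_range_of_periodic_pair
    (linearIndependent_pair_of_div_notMem_range_ofReal hw₂ hratio) hF.continuous hper₁ hper₂
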